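/- Let SB_n denote the number of semi-Baxter permutations of size n, and let a_m = Σ_{j=0}^{m} binomial(m,j)²·binomial(m+j,j) (the Apéry numbers, sequence A005258). For every n ≥ 2, the following identity holds in ℤ: 5·(n−1)·n²·(n+2)²·(n+3)²·(n+4)·SB_n = 24·((5n³−5n+6)·a_{n+1} − (5n²+15n+18)·a_n). (Proposition 3.16.) -/

import Mathlib

/-- `f` contains the vincular pattern 2-41-3: there are positions
`i < j` and `k > j+1` with `f (j+1) < f i < f k < f j`. -/
def Contains2413 {m : ℕ} (f : Fin m → Fin m) : Prop :=
  ∃ i j j' k : Fin m, (i : ℕ) < (j : ℕ) ∧ (j' : ℕ) = (j : ℕ) + 1 ∧ (j' : ℕ) < (k : ℕ) ∧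
    f j' < f i ∧ f i < f k ∧ f k < f j

/-- A semi-Baxter permutation avoids 2-41-3. -/
def IsSemiBaxter {n : ℕ} (π : Equiv.Perm (Fin n)) : Prop := ¬ Contains2413 ⇑π

/-- The number of semi-Baxter permutations of size `n`. -/
noncomputable def semiBaxterCount (n : ℕ) : ℕ :=
  Nat.card {π : Equiv.Perm (Fin n) // IsSemiBaxter π}

/-- The Apéry numbers (OEIS A005258): `a m = Σ_j C(m,j)² C(m+j,j)`. -/
def apery (m : ℕ) : ℕ :=
  ∑ j ∈ Finset.range (m + 1), (Nat.choose m j) ^ 2 * Nat.choose (m + j) j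

section

open Finset

/-! ### The generating tree -/

/-- The number of nodes at depth `d` below a node labelled `(h, k)` in the generating tree with
succession rule `(h, k) ↦ (1, k + 1), …, (h, k + 1), (h + k, 1), …, (h + 1, k)`. -/
def treeCount : ℕ → ℕ → ℕ → ℕ
  | 0, _, _ => 1
  | d + 1, h, k =>
    ∑ i ∈ Finset.range h, treeCount d (i + 1) (k + 1) +
      ∑ i ∈ Finset.range k, treeCount d (h + i + 1) (k - i)

/-- Append a last entry `a` to the permutation `π`, shifting up the entries that are `≥ a`. -/
def appendEntry {n : ℕ} (a : Fin (n + 1)) (π : Equiv.Perm (Fin n)) : Equiv.Perm (Fin (n + 1)) :=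
  finSuccEquivLast.trans (π.optionCongr.trans (finSuccEquiv' a).symm)

@[simp]
lemma appendEntry_last {n : ℕ} (a : Fin (n + 1)) (π : Equiv.Perm (Fin n)) :
    appendEntry a π (Fin.last n) = a := by
  simp [appendEntry]

@[simp]
lemma appendEntry_castSucc {n : ℕ} (a : Fin (n + 1)) (π : Equiv.Perm (Fin n)) (i : Fin n) :
    appendEntry a π i.castSucc = a.succAbove (π i) := by
  simp [appendEntry]

lemma appendEntry_bijective (n : ℕ) :
    Function.Bijective fun x : Fin (n + 1) × Equiv.Perm (Fin n) => appendEntry x.1 x.2 := by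
  rw [Fintype.bijective_iff_injective_and_card]
  refine ⟨?_, by simp [Fintype.card_perm, Nat.factorial_succ]⟩
  rintro ⟨a, π⟩ ⟨b, ρ⟩ h
  have hab : a = b := by simpa using DFunLike.congr_fun h (Fin.last n)
  subst hab
  refine Prod.ext rfl (Equiv.ext fun i => ?_)
  simpa using DFunLike.congr_fun h i.castSucc

open Classical in
/-- The sites (cut values) of `π` at which no `2-41` pattern forbids a further entry. -/
noncomputable def activeSites {n : ℕ} (π : Equiv.Perm (Fin n)) : Finset ℕ :=
  {g ∈ Finset.range (n + 1) | ¬ ∃ i j j' : Fin n, (i : ℕ) < j ∧ (j' : ℕ) = j + 1 ∧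
    π j' < π i ∧ (π i : ℕ) < g ∧ g ≤ (π j : ℕ)}

lemma mem_activeSites {n : ℕ} {π : Equiv.Perm (Fin n)} {g : ℕ} :
    g ∈ activeSites π ↔ g ≤ n ∧ ¬ ∃ i j j' : Fin n, (i : ℕ) < j ∧ (j' : ℕ) = j + 1 ∧
      π j' < π i ∧ (π i : ℕ) < g ∧ g ≤ (π j : ℕ) := by
  simp [activeSites]

lemma val_succAbove {n : ℕ} (a : Fin (n + 1)) (x : Fin n) :
    (a.succAbove x : ℕ) = if (x : ℕ) < a then (x : ℕ) else x + 1 := by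
  simp only [Fin.succAbove, Fin.lt_def, Fin.val_castSucc]
  split_ifs <;> simp

lemma isSemiBaxter_appendEntry {n : ℕ} (a : Fin (n + 1)) (π : Equiv.Perm (Fin n)) :
    IsSemiBaxter (appendEntry a π) ↔ IsSemiBaxter π ∧ (a : ℕ) ∈ activeSites π := by
  rw [IsSemiBaxter, IsSemiBaxter, mem_activeSites, and_iff_right (Nat.lt_succ_iff.mp a.isLt),
    ← not_or, not_iff_not]
  constructor
  · rintro ⟨i, j, j', k, hij, hj, hk, h1, h2, h3⟩
    induction k using Fin.lastCases with
    | last =>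
      right
      simp only [Fin.val_last] at hk
      obtain ⟨i, rfl⟩ := Fin.exists_castSucc_eq.2 (show i ≠ Fin.last n by
        rintro rfl; simp at hij; omega)
      obtain ⟨j, rfl⟩ := Fin.exists_castSucc_eq.2 (show j ≠ Fin.last n by
        rintro rfl; simp at hj; omega)
      obtain ⟨j', rfl⟩ := Fin.exists_castSucc_eq.2 (show j' ≠ Fin.last n by
        rintro rfl; simp at hk)
      simp only [appendEntry_castSucc, appendEntry_last, Fin.lt_def, val_succAbove] at h1 h2 h3
      refine ⟨i, j, j', by simpa using hij, by simpa using hj, ?_⟩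
      rw [Fin.lt_def]
      split_ifs at h1 h2 h3 <;> omega
    | cast k =>
      left
      have := k.isLt
      simp only [Fin.val_castSucc] at hk
      obtain ⟨i, rfl⟩ := Fin.exists_castSucc_eq.2 (show i ≠ Fin.last n by
        rintro rfl; simp at hij; omega)
      obtain ⟨j, rfl⟩ := Fin.exists_castSucc_eq.2 (show j ≠ Fin.last n by
        rintro rfl; simp at hj; omega)
      obtain ⟨j', rfl⟩ := Fin.exists_castSucc_eq.2 (show j' ≠ Fin.last n by
        rintro rfl; simp at hk; omega)
      simp only [appendEntry_castSucc, Fin.succAbove_lt_succAbove_iff] at h1 h2 h3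
      exact ⟨i, j, j', k, hij, hj, hk, h1, h2, h3⟩
  · rintro (⟨i, j, j', k, hij, hj, hk, h1, h2, h3⟩ | ⟨i, j, j', hij, hj, h1, h2, h3⟩)
    · refine ⟨i.castSucc, j.castSucc, j'.castSucc, k.castSucc, hij, hj, hk, ?_⟩
      simpa only [appendEntry_castSucc, Fin.succAbove_lt_succAbove_iff] using ⟨h1, h2, h3⟩
    · refine ⟨i.castSucc, j.castSucc, j'.castSucc, Fin.last n, hij, hj, by simp, ?_⟩
      rw [Fin.lt_def] at h1
      simp only [appendEntry_castSucc, appendEntry_last, Fin.lt_def, val_succAbove]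
      refine ⟨?_, ?_, ?_⟩ <;> split_ifs <;> omega

lemma mem_activeSites_appendEntry {n : ℕ} (a : Fin (n + 2)) (π : Equiv.Perm (Fin (n + 1)))
    (g : ℕ) :
    g ∈ activeSites (appendEntry a π) ↔
      (g ≤ a ∧ g ∈ activeSites π) ∨
        ((a : ℕ) < g ∧ g - 1 ∈ activeSites π ∧
          ¬ ((a : ℕ) < g - 1 ∧ g - 1 ≤ (π (Fin.last n) : ℕ))) := by
  have ha := a.isLt
  simp only [mem_activeSites]
  constructor
  · rintro ⟨hg, hn⟩
    have old : ∀ x, (g ≤ a ∧ x = g ∨ (a : ℕ) < g ∧ x = g - 1) →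
        ¬ ∃ i j j' : Fin (n + 1), (i : ℕ) < j ∧ (j' : ℕ) = j + 1 ∧
          π j' < π i ∧ (π i : ℕ) < x ∧ x ≤ (π j : ℕ) := by
      rintro x hx ⟨i, j, j', hij, hj, h1, h2, h3⟩
      refine hn ⟨i.castSucc, j.castSucc, j'.castSucc, hij, hj, ?_⟩
      rw [Fin.lt_def] at h1
      simp only [appendEntry_castSucc, Fin.lt_def, val_succAbove]
      refine ⟨?_, ?_, ?_⟩ <;> split_ifs <;> omega
    rcases le_or_gt g a with hga | hga
    · exact Or.inl ⟨hga, by omega, old g (Or.inl ⟨hga, rfl⟩)⟩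
    · refine Or.inr ⟨hga, ⟨by omega, old (g - 1) (Or.inr ⟨hga, rfl⟩)⟩, ?_⟩
      rintro ⟨h1, h2⟩
      have hl := (π (Fin.last n)).isLt
      obtain ⟨i, hi⟩ := π.surjective ⟨a, by omega⟩
      have hi' : (π i : ℕ) = a := by rw [hi]
      have hil : i ≠ Fin.last n := by
        rintro rfl
        omega
      have hil' := Fin.val_lt_last hil
      refine hn ⟨i.castSucc, (Fin.last n).castSucc, Fin.last (n + 1), by simpa using hil',
        by simp, ?_⟩
      simp only [appendEntry_castSucc, appendEntry_last, Fin.lt_def, val_succAbove]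
      refine ⟨?_, ?_, ?_⟩ <;> split_ifs <;> omega
  · intro h
    refine ⟨by omega, ?_⟩
    rintro ⟨i, j, j', hij, hj, h1, h2, h3⟩
    have hj'lt := j'.isLt
    obtain ⟨i, rfl⟩ := Fin.exists_castSucc_eq.2 (show i ≠ Fin.last (n + 1) by
      rintro rfl; simp at hij; omega)
    obtain ⟨j, rfl⟩ := Fin.exists_castSucc_eq.2 (show j ≠ Fin.last (n + 1) by
      rintro rfl; simp at hj; omega)
    simp only [Fin.val_castSucc] at hij hj
    induction j' using Fin.lastCases with
    | last =>
      have hjl : j = Fin.last n := Fin.ext (by simpa using hj.symm)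
      subst hjl
      simp only [appendEntry_castSucc, appendEntry_last, Fin.lt_def, val_succAbove] at h1 h2 h3
      rcases h with h | ⟨h4, h5, h6⟩
      · split_ifs at h1 h2 h3 <;> omega
      · split_ifs at h1 h2 h3 <;> omega
    | cast j' =>
      simp only [appendEntry_castSucc, Fin.lt_def, val_succAbove] at h1 h2 h3
      rcases h with ⟨h4, h5, h6⟩ | ⟨h4, ⟨h5, h6⟩, -⟩
      · refine h6 ⟨i, j, j', hij, hj, ?_⟩
        rw [Fin.lt_def]
        split_ifs at h1 h2 h3 <;> omega
      · refine h6 ⟨i, j, j', hij, hj, ?_⟩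
        rw [Fin.lt_def]
        split_ifs at h1 h2 h3 <;> omega

/-- The number of active sites of `π` below its last entry. -/
noncomputable def lowerSites {n : ℕ} (π : Equiv.Perm (Fin (n + 1))) : ℕ :=
  #{g ∈ activeSites π | g ≤ (π (Fin.last n) : ℕ)}

/-- The number of active sites of `π` above its last entry. -/
noncomputable def upperSites {n : ℕ} (π : Equiv.Perm (Fin (n + 1))) : ℕ :=
  #{g ∈ activeSites π | (π (Fin.last n) : ℕ) < g}

lemma lowerSites_appendEntry {n : ℕ} (a : Fin (n + 2)) (π : Equiv.Perm (Fin (n + 1)))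
    (ha : (a : ℕ) ∈ activeSites π) :
    lowerSites (appendEntry a π) = #{g ∈ activeSites π | g < (a : ℕ)} + 1 := by
  rw [lowerSites, appendEntry_last]
  have : {g ∈ activeSites (appendEntry a π) | g ≤ (a : ℕ)} =
      insert (a : ℕ) {g ∈ activeSites π | g < (a : ℕ)} := by
    ext g
    simp only [Finset.mem_filter, Finset.mem_insert, mem_activeSites_appendEntry]
    constructor
    · rintro ⟨h1 | h1, h2⟩
      · rcases h2.eq_or_lt with h3 | h3
        · exact Or.inl h3
        · exact Or.inr ⟨h1.2, h3⟩
      · omega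
    · rintro (rfl | h)
      · exact ⟨Or.inl ⟨le_rfl, ha⟩, le_rfl⟩
      · exact ⟨Or.inl ⟨h.2.le, h.1⟩, h.2.le⟩
  rw [this, Finset.card_insert_of_notMem (by simp)]

lemma upperSites_appendEntry {n : ℕ} (a : Fin (n + 2)) (π : Equiv.Perm (Fin (n + 1))) :
    upperSites (appendEntry a π) = #{g ∈ activeSites π | (a : ℕ) ≤ g ∧
      ¬ ((a : ℕ) < g ∧ g ≤ (π (Fin.last n) : ℕ))} := by
  rw [upperSites, appendEntry_last]
  symm
  refine Finset.card_bij (fun g _ => g + 1) ?_ (fun _ _ _ _ h => Nat.succ_injective h) ?_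
  · intro g hg
    simp only [Finset.mem_filter, mem_activeSites_appendEntry, Nat.add_sub_cancel] at hg ⊢
    exact ⟨Or.inr ⟨by omega, hg.1, hg.2.2⟩, by omega⟩
  · intro g hg
    simp only [Finset.mem_filter, mem_activeSites_appendEntry] at hg ⊢
    rcases hg with ⟨h1 | h1, h2⟩
    · omega
    · exact ⟨g - 1, ⟨h1.2.1, by omega, h1.2.2⟩, by omega⟩

lemma upperSites_appendEntry_of_le {n : ℕ} (a : Fin (n + 2)) (π : Equiv.Perm (Fin (n + 1)))
    (ha : (a : ℕ) ∈ activeSites π) (hle : (a : ℕ) ≤ (π (Fin.last n) : ℕ)) :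
    upperSites (appendEntry a π) = upperSites π + 1 := by
  rw [upperSites_appendEntry, upperSites]
  have : {g ∈ activeSites π | (a : ℕ) ≤ g ∧ ¬ ((a : ℕ) < g ∧ g ≤ (π (Fin.last n) : ℕ))} =
      insert (a : ℕ) {g ∈ activeSites π | (π (Fin.last n) : ℕ) < g} := by
    ext g
    simp only [Finset.mem_filter, Finset.mem_insert]
    constructor
    · rintro ⟨h1, h2⟩
      by_cases h : g = a
      · exact Or.inl h
      · exact Or.inr ⟨h1, by omega⟩
    · rintro (rfl | h)
      · exact ⟨ha, by omega⟩
      · exact ⟨h.1, by omega⟩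
  rw [this, Finset.card_insert_of_notMem (by simp; omega)]

lemma upperSites_appendEntry_of_lt {n : ℕ} (a : Fin (n + 2)) (π : Equiv.Perm (Fin (n + 1)))
    (hlt : (π (Fin.last n) : ℕ) < a) :
    upperSites (appendEntry a π) =
      lowerSites π + upperSites π - #{g ∈ activeSites π | g < (a : ℕ)} := by
  have h1 : lowerSites π + upperSites π = #(activeSites π) := by
    rw [lowerSites, upperSites, ← Finset.card_filter_add_card_filter_not
      (s := activeSites π) (fun g => g ≤ (π (Fin.last n) : ℕ))]
    simp only [not_le]
  have h2 := Finset.card_filter_add_card_filter_not (s := activeSites π) (fun g => g < (a : ℕ))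
  have h3 : upperSites (appendEntry a π) = #{g ∈ activeSites π | ¬ g < (a : ℕ)} := by
    rw [upperSites_appendEntry]
    congr 1
    refine Finset.filter_congr fun g _ => ?_
    omega
  omega

/-- Summing a function of the rank of an element of a finite set of natural numbers. -/
lemma sum_rank {M : Type*} [AddCommMonoid M] (S : Finset ℕ) (f : ℕ → M) :
    ∑ g ∈ S, f #{x ∈ S | x < g} = ∑ i ∈ Finset.range #S, f i := by
  induction S using Finset.induction_on_max with
  | empty => simp
  | insert a S ha ih =>
    have hn : a ∉ S := fun h => lt_irrefl _ (ha a h)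
    rw [Finset.sum_insert hn, Finset.card_insert_of_notMem hn, Finset.sum_range_succ, ← ih,
      add_comm]
    congr 1
    · refine Finset.sum_congr rfl fun g hg => ?_
      rw [Finset.filter_insert, if_neg (ha g hg).not_gt]
    · rw [Finset.filter_insert, if_neg (lt_irrefl a), Finset.filter_true_of_mem ha]

lemma sum_activeSites_treeCount {n : ℕ} (π : Equiv.Perm (Fin (n + 1))) (d : ℕ) :
    ∑ a : Fin (n + 2), (if (a : ℕ) ∈ activeSites π then
      treeCount d (lowerSites (appendEntry a π)) (upperSites (appendEntry a π)) else 0) =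
      treeCount (d + 1) (lowerSites π) (upperSites π) := by
  set h := lowerSites π with hh
  set k := upperSites π with hk
  have hcard : h + k = #(activeSites π) := by
    rw [hh, hk, lowerSites, upperSites, ← Finset.card_filter_add_card_filter_not
      (s := activeSites π) (fun g => g ≤ (π (Fin.last n) : ℕ))]
    simp only [not_le]
  let f : ℕ → ℕ := fun i =>
    if i < h then treeCount d (i + 1) (k + 1) else treeCount d (i + 1) (h + k - i)
  have key : ∀ a : Fin (n + 2), (a : ℕ) ∈ activeSites π →
      treeCount d (lowerSites (appendEntry a π)) (upperSites (appendEntry a π)) =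
        f #{x ∈ activeSites π | x < (a : ℕ)} := by
    intro a ha
    rw [lowerSites_appendEntry a π ha]
    rcases le_or_gt (a : ℕ) (π (Fin.last n) : ℕ) with hle | hlt
    · have : #{x ∈ activeSites π | x < (a : ℕ)} < h := by
        refine Finset.card_lt_card (Finset.ssubset_iff_of_subset ?_ |>.2 ⟨a, ?_, ?_⟩)
        · intro x
          simp only [Finset.mem_filter]
          exact fun hx => ⟨hx.1, by omega⟩
        · simp [ha, hle]
        · simp
      rw [upperSites_appendEntry_of_le a π ha hle]
      simp only [f, if_pos this]
      rfl
    · have : ¬ #{x ∈ activeSites π | x < (a : ℕ)} < h := by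
        refine not_lt.2 (Finset.card_le_card ?_)
        intro x
        simp only [Finset.mem_filter]
        exact fun hx => ⟨hx.1, by omega⟩
      rw [upperSites_appendEntry_of_lt a π hlt]
      simp only [f, if_neg this]
      rfl
  have e1 : ∑ a : Fin (n + 2), (if (a : ℕ) ∈ activeSites π then
      treeCount d (lowerSites (appendEntry a π)) (upperSites (appendEntry a π)) else 0) =
      ∑ g ∈ activeSites π, f #{x ∈ activeSites π | x < g} := by
    calc _ = ∑ a : Fin (n + 2), (fun g : ℕ => if g ∈ activeSites π then
          f #{x ∈ activeSites π | x < g} else 0) a := by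
          refine Finset.sum_congr rfl fun a _ => ?_
          split_ifs with ha
          · simp only [key a ha, if_pos ha]
          · simp only [if_neg ha]
      _ = ∑ g ∈ Finset.range (n + 2), (if g ∈ activeSites π then
          f #{x ∈ activeSites π | x < g} else 0) :=
          Fin.sum_univ_eq_sum_range (fun g : ℕ => if g ∈ activeSites π then
            f #{x ∈ activeSites π | x < g} else 0) (n + 2)
      _ = _ := by
          rw [← Finset.sum_filter]
          refine Finset.sum_congr ?_ fun _ _ => rfl
          ext g
          simp only [Finset.mem_filter, Finset.mem_range, and_iff_right_iff_imp]
          intro hg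
          have := (mem_activeSites.1 hg).1
          omega
  rw [e1, sum_rank, ← hcard, Finset.sum_range_add, treeCount]
  congr 1
  · refine Finset.sum_congr rfl fun i hi => ?_
    simp only [f, if_pos (Finset.mem_range.1 hi)]
  · refine Finset.sum_congr rfl fun i hi => ?_
    simp only [f, if_neg (show ¬ h + i < h by omega)]
    congr 1
    omega

open Classical in
lemma sum_treeCount_labels (n d : ℕ) :
    ∑ π : Equiv.Perm (Fin (n + 1)), (if IsSemiBaxter π then
      treeCount d (lowerSites π) (upperSites π) else 0) = treeCount (d + n) 1 1 := by
  induction n generalizing d with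
  | zero =>
    have hsemi : ∀ π : Equiv.Perm (Fin 1), IsSemiBaxter π := by
      rintro π ⟨i, j, -, -, h, -⟩
      omega
    have hact : ∀ (π : Equiv.Perm (Fin 1)) g, g ∈ activeSites π ↔ g ≤ 1 := by
      intro π g
      rw [mem_activeSites, and_iff_left_iff_imp]
      rintro - ⟨i, j, -, h, -⟩
      omega
    have hl : ∀ π : Equiv.Perm (Fin 1), lowerSites π = 1 := by
      intro π
      rw [lowerSites, Finset.card_eq_one]
      refine ⟨0, Finset.ext fun g => ?_⟩
      have := (π (Fin.last 0)).isLt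
      simp only [Finset.mem_filter, hact, Finset.mem_singleton]
      omega
    have hu : ∀ π : Equiv.Perm (Fin 1), upperSites π = 1 := by
      intro π
      rw [upperSites, Finset.card_eq_one]
      refine ⟨1, Finset.ext fun g => ?_⟩
      have := (π (Fin.last 0)).isLt
      simp only [Finset.mem_filter, hact, Finset.mem_singleton]
      omega
    simp [hsemi, hl, hu]
  | succ n ih =>
    rw [← (appendEntry_bijective (n + 1)).sum_comp, Fintype.sum_prod_type, Finset.sum_comm,
      show d + (n + 1) = d + 1 + n by ring, ← ih (d + 1)]
    refine Finset.sum_congr rfl fun π _ => ?_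
    by_cases hπ : IsSemiBaxter π
    · simp only [isSemiBaxter_appendEntry, hπ, true_and, if_true]
      exact sum_activeSites_treeCount π d
    · simp [isSemiBaxter_appendEntry, hπ]

lemma semiBaxterCount_succ (n : ℕ) : semiBaxterCount (n + 1) = treeCount n 1 1 := by
  classical
  have := sum_treeCount_labels n 0
  simp only [treeCount, zero_add] at this
  rw [← this, semiBaxterCount, Nat.card_eq_fintype_card, Fintype.card_subtype,
    Finset.card_filter]

end

/-! ### Binomial coefficients with integer arguments and a convolution sum -/

/-- The binomial coefficient with integer arguments, zero if the lower argument is negative. -/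
def intChoose (n k : ℤ) : ℤ := if k < 0 then 0 else Ring.choose n k.toNat

lemma intChoose_of_neg {n k : ℤ} (h : k < 0) : intChoose n k = 0 := if_pos h

lemma intChoose_natCast (n k : ℕ) : intChoose n k = n.choose k := by
  rw [intChoose, if_neg (by omega), Int.toNat_natCast, Ring.choose_natCast]

@[simp]
lemma intChoose_zero_right (n : ℤ) : intChoose n 0 = 1 := by
  simp [intChoose]

lemma intChoose_of_lt {n k : ℤ} (hn : 0 ≤ n) (h : n < k) : intChoose n k = 0 := by
  lift n to ℕ using hn
  lift k to ℕ using (by omega)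
  rw [intChoose_natCast, Nat.choose_eq_zero_of_lt (by omega), Nat.cast_zero]

lemma intChoose_succ (n k : ℤ) : intChoose (n + 1) k = intChoose n k + intChoose n (k - 1) := by
  rcases lt_trichotomy k 0 with h | rfl | h
  · rw [intChoose_of_neg h, intChoose_of_neg h, intChoose_of_neg (by omega), add_zero]
  · rw [intChoose_zero_right, intChoose_zero_right, intChoose_of_neg (by omega), add_zero]
  · lift k to ℕ using h.le
    obtain ⟨k, rfl⟩ := Nat.exists_eq_succ_of_ne_zero (n := k) (by omega)
    rw [intChoose, intChoose, intChoose, if_neg (by omega), if_neg (by omega), if_neg (by omega),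
      Int.toNat_natCast, show ((k.succ : ℕ) - 1 : ℤ).toNat = k by omega, Nat.succ_eq_add_one,
      Ring.choose_succ_succ, add_comm]

lemma intChoose_symm {n : ℤ} (hn : 0 ≤ n) (k : ℤ) : intChoose n (n - k) = intChoose n k := by
  rcases lt_or_ge k 0 with h | h
  · rw [intChoose_of_neg h, intChoose_of_lt hn (by omega)]
  rcases lt_or_ge n k with h' | h'
  · rw [intChoose_of_lt hn h', intChoose_of_neg (by omega)]
  lift n to ℕ using hn
  lift k to ℕ using h
  have hk : k ≤ n := by omega
  rw [← Nat.cast_sub hk, intChoose_natCast, intChoose_natCast, Nat.choose_symm hk]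

lemma intChoose_mul {n v : ℤ} (hn : 0 ≤ n) (hv : 0 ≤ v) (s : ℤ) :
    intChoose n s * intChoose (n - s) (v - s) = intChoose n v * intChoose v s := by
  rcases lt_or_ge s 0 with h | h
  · rw [intChoose_of_neg h, intChoose_of_neg h, zero_mul, mul_zero]
  rcases lt_or_ge v s with h' | h'
  · rw [intChoose_of_neg (show v - s < 0 by omega), intChoose_of_lt hv h', mul_zero, mul_zero]
  rcases lt_or_ge n v with h'' | h''
  · rw [intChoose_of_lt hn h'', zero_mul]
    rcases lt_or_ge n s with h3 | h3
    · rw [intChoose_of_lt hn h3, zero_mul]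
    · rw [intChoose_of_lt (show 0 ≤ n - s by omega) (by omega), mul_zero]
  lift n to ℕ using hn
  lift v to ℕ using hv
  lift s to ℕ using h
  have h1 : s ≤ n := by omega
  have h2 : s ≤ v := by omega
  rw [← Nat.cast_sub h1, ← Nat.cast_sub h2]
  simp only [intChoose_natCast]
  exact_mod_cast (Nat.choose_mul h2).symm

/-- The sum of `C(n, s) C(p, u - s) g(s)` over all integers `s`. -/
noncomputable def chooseConv (n p u : ℤ) (g : ℤ → ℤ) : ℤ :=
  ∑ᶠ s : ℤ, intChoose n s * intChoose p (u - s) * g s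

lemma hasFiniteSupport_chooseConv (n p u : ℤ) (g : ℤ → ℤ) :
    (fun s : ℤ => intChoose n s * intChoose p (u - s) * g s).HasFiniteSupport := by
  refine (Set.finite_Icc (0 : ℤ) u).subset fun s hs => ?_
  rw [Function.mem_support] at hs
  by_contra h
  rw [Set.mem_Icc, not_and_or, not_le, not_le] at h
  rcases h with h | h
  · exact hs (by rw [intChoose_of_neg h, zero_mul, zero_mul])
  · exact hs (by rw [intChoose_of_neg (show u - s < 0 by omega), mul_zero, zero_mul])

lemma chooseConv_add (n p u : ℤ) (f g : ℤ → ℤ) :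
    chooseConv n p u (fun s => f s + g s) = chooseConv n p u f + chooseConv n p u g := by
  rw [chooseConv, chooseConv, chooseConv, ← finsum_add_distrib
    (hasFiniteSupport_chooseConv n p u f) (hasFiniteSupport_chooseConv n p u g)]
  exact finsum_congr fun s => by ring

lemma chooseConv_shift (n p u c : ℤ) (g : ℤ → ℤ) :
    ∑ᶠ s : ℤ, intChoose n (s + c) * intChoose p (u - (s + c)) * g (s + c) =
      chooseConv n p u g :=
  finsum_comp_equiv (Equiv.addRight c)
    (f := fun s => intChoose n s * intChoose p (u - s) * g s)

lemma chooseConv_succ_left (n p u : ℤ) (g : ℤ → ℤ) :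
    chooseConv (n + 1) p u g =
      chooseConv n p u g + chooseConv n p (u - 1) (fun s => g (s + 1)) := by
  rw [← chooseConv_shift n p (u - 1) (-1), chooseConv, chooseConv, ← finsum_add_distrib
    (hasFiniteSupport_chooseConv n p u g)]
  · refine finsum_congr fun s => ?_
    rw [intChoose_succ, show u - 1 - (s + -1) = u - s by ring, show s + -1 + 1 = s by ring,
      ← sub_eq_add_neg]
    ring
  · refine (hasFiniteSupport_chooseConv n p (u - 1) fun s => g (s + 1)).preimage
      (f := fun s : ℤ => s + -1) ?_
    exact (add_left_injective (-1 : ℤ)).injOn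

lemma chooseConv_succ_right (n p u : ℤ) (g : ℤ → ℤ) :
    chooseConv n (p + 1) u g = chooseConv n p u g + chooseConv n p (u - 1) g := by
  rw [chooseConv, chooseConv, chooseConv, ← finsum_add_distrib
    (hasFiniteSupport_chooseConv n p u g) (hasFiniteSupport_chooseConv n p (u - 1) g)]
  refine finsum_congr fun s => ?_
  rw [intChoose_succ, show u - s - 1 = u - 1 - s by ring]
  ring

lemma chooseConv_symm {n p : ℤ} (hn : 0 ≤ n) (hp : 0 ≤ p) (u : ℤ) (g : ℤ → ℤ) :
    chooseConv n p u g = chooseConv p n (n + p - u) (fun s => g (s - p + u)) := by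
  rw [← chooseConv_shift p n _ (p - u), chooseConv]
  refine finsum_congr fun s => ?_
  rw [show s + (p - u) = p - (u - s) by ring, intChoose_symm hp,
    show n + p - u - (p - (u - s)) = n - s by ring, intChoose_symm hn,
    show p - (u - s) - p + u = s by ring]
  ring

/-- The Chu–Vandermonde identity. -/
lemma chooseConv_one {v : ℤ} (hv : 0 ≤ v) (p u : ℤ) :
    chooseConv v p u (fun _ => 1) = intChoose (v + p) u := by
  induction v, hv using Int.leInduction generalizing u with
  | base =>
    rw [chooseConv, finsum_eq_single _ 0]
    · simp
    · intro s hs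
      rcases lt_or_gt_of_ne hs with h | h
      · rw [intChoose_of_neg h, zero_mul, zero_mul]
      · rw [intChoose_of_lt le_rfl h, zero_mul, zero_mul]
  | succ v _ ih =>
    rw [chooseConv_succ_left, ih, ih, add_right_comm, intChoose_succ]

/-- The sum `∑ₛ C(n, s) C(p, u - s) C(n + m - s, v - s)`. -/
noncomputable def tripleSum (m n p u v : ℤ) : ℤ :=
  chooseConv n p u (fun s => intChoose (n + m - s) (v - s))

lemma tripleSum_of_neg {v : ℤ} (hv : v < 0) (m n p u : ℤ) : tripleSum m n p u v = 0 := by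
  rw [tripleSum, chooseConv]
  refine finsum_eq_zero_of_forall_eq_zero fun s => ?_
  rcases lt_or_ge s 0 with h | h
  · rw [intChoose_of_neg h, zero_mul, zero_mul]
  · rw [intChoose_of_neg (show v - s < 0 by omega), mul_zero]

lemma tripleSum_succ_first (m n p u v : ℤ) :
    tripleSum (m + 1) n p u v = tripleSum m n p u v + tripleSum m n p u (v - 1) := by
  rw [tripleSum, tripleSum, tripleSum, ← chooseConv_add]
  congr 1
  funext s
  rw [show n + (m + 1) - s = n + m - s + 1 by ring, intChoose_succ,
    show v - s - 1 = v - 1 - s by ring]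

lemma tripleSum_succ_second (m n p u v : ℤ) :
    tripleSum m (n + 1) p u v = tripleSum (m + 1) n p u v + tripleSum m n p (u - 1) (v - 1) := by
  rw [tripleSum, tripleSum, tripleSum, chooseConv_succ_left]
  congr 2 <;> funext s <;> congr 1 <;> ring

lemma tripleSum_succ_third (m n p u v : ℤ) :
    tripleSum m n (p + 1) u v = tripleSum m n p u v + tripleSum m n p (u - 1) v :=
  chooseConv_succ_right _ _ _ _

/-- The symmetry of `tripleSum` exchanging the second and third arguments. -/
lemma tripleSum_swap {n p : ℤ} (hn : 0 ≤ n) (hp : 0 ≤ p) (m u v : ℤ) :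
    tripleSum m n p u v = tripleSum (n + m - u) p n (n + p - u) (v + p - u) := by
  rw [tripleSum, tripleSum, chooseConv_symm hn hp]
  congr 1
  funext s
  congr 1 <;> ring

lemma tripleSum_eq_chooseConv {m n p v : ℤ} (hm : 0 ≤ m) (hn : 0 ≤ n)
    (hmv : m ≤ p + v) (u : ℤ) :
    tripleSum m n p u v =
      chooseConv m (p + v - m) (p + v - u) (fun s => intChoose (n + s) v) := by
  induction m, hm using Int.leInduction generalizing v with
  | base =>
    have hR : chooseConv 0 (p + v - 0) (p + v - u) (fun s => intChoose (n + s) v) =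
        intChoose (p + v) u * intChoose n v := by
      rw [chooseConv, finsum_eq_single _ 0]
      · rw [← intChoose_symm hmv u]
        simp
      · intro s hs
        rcases lt_or_gt_of_ne hs with h | h
        · rw [intChoose_of_neg h, zero_mul, zero_mul]
        · rw [intChoose_of_lt le_rfl h, zero_mul, zero_mul]
    rw [hR]
    rcases lt_or_ge v 0 with hv | hv
    · rw [tripleSum_of_neg hv, intChoose_of_neg hv, mul_zero]
    · rw [add_comm p v, ← chooseConv_one hv, tripleSum, chooseConv, chooseConv, finsum_mul]
      refine finsum_congr fun s => ?_
      have := intChoose_mul hn hv s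
      rw [add_zero, mul_right_comm, this]
      ring
  | succ m hm ih =>
    rw [tripleSum_succ_first, ih (by omega), ih (by omega), chooseConv_succ_left]
    have h1 := chooseConv_succ_right m (p + v - (m + 1)) (p + v - u)
      (fun s => intChoose (n + s) v)
    rw [show p + v - (m + 1) + 1 = p + v - m by ring] at h1
    rw [h1, show p + (v - 1) - m = p + v - (m + 1) by ring,
      show p + (v - 1) - u = p + v - u - 1 by ring, add_assoc, ← chooseConv_add]
    congr 2
    funext s
    rw [← intChoose_succ]
    congr 1
    ring

/-- The symmetry of `tripleSum` coming from the involution `m ↦ p + v - m`. -/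
lemma tripleSum_reflect {m n p u v : ℤ} (hn : 0 ≤ n) (hn' : 0 ≤ n + m - u)
    (h : v < 0 ∨ 0 ≤ m ∧ m ≤ p + v) :
    tripleSum m n p u v = tripleSum (p + v - m) (n + m - u) p (p + v - u) v := by
  rcases h with h | ⟨h1, h2⟩
  · rw [tripleSum_of_neg h, tripleSum_of_neg h]
  · rw [tripleSum_eq_chooseConv h1 hn h2, tripleSum_eq_chooseConv (by omega) hn' (by omega),
      chooseConv_symm h1 (by omega)]
    congr 1
    · ring
    · ring
    · funext s
      congr 1
      ring

/-- The alternating sum over the orbit of a parameter shift under the two symmetries of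
`tripleSum`. -/
def orbitSum (f : ℤ → ℤ → ℤ → ℤ → ℤ → ℤ) : ℤ :=
  -f (-2) 1 1 (-1) (-2) + f 0 1 1 1 (-2) - f 0 0 2 0 (-3) + f (-2) 1 2 0 (-3)
    - f (-1) 1 2 2 (-2) + f 0 (-1) 2 (-1) (-2) - f 0 1 0 1 0 + f (-1) 1 0 0 0
    - f 0 (-1) 2 0 (-1) + f 0 0 2 2 (-1)

lemma orbitSum_add (f g : ℤ → ℤ → ℤ → ℤ → ℤ → ℤ) :
    orbitSum (fun a b c d e => f a b c d e + g a b c d e) = orbitSum f + orbitSum g := by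
  simp only [orbitSum]
  ring

/-- A closed form of `treeCount`. -/
noncomputable def treeSum (d h k : ℤ) : ℤ :=
  orbitSum fun a b c x y => tripleSum (d + h + a) (d + k + b) (d + c) (d + x) (d + y)

/-- A closed form of the first sum in the recursion of `treeCount`. -/
noncomputable def treeSumLeft (d h k : ℤ) : ℤ :=
  orbitSum fun a b c x y =>
    tripleSum (d + 1 + h + a) (d + 1 + k + b) (d + c) (d + x) (d + 1 + y)

/-- A closed form of the second sum in the recursion of `treeCount`. -/
noncomputable def treeSumRight (d h k : ℤ) : ℤ :=
  orbitSum fun a b c x y =>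
    tripleSum (d + 1 + h + a) (d + 1 + k + b) (d + c) (d + 1 + x) (d + 1 + y)

lemma treeSum_succ (d h k : ℤ) :
    treeSum (d + 1) h k = treeSumLeft d h k + treeSumRight d h k := by
  rw [treeSum, treeSumLeft, treeSumRight, ← orbitSum_add]
  congr 1
  funext a b c x y
  rw [show d + 1 + c = d + c + 1 by ring, tripleSum_succ_third, add_comm,
    show d + 1 + x - 1 = d + x by ring]

lemma treeSumLeft_succ (d h k : ℤ) :
    treeSumLeft d (h + 1) k = treeSumLeft d h k + treeSum d (h + 1) (k + 1) := by
  rw [treeSum, treeSumLeft, treeSumLeft, ← orbitSum_add]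
  congr 1
  funext a b c x y
  rw [show d + 1 + (h + 1) + a = d + 1 + h + a + 1 by ring, tripleSum_succ_first]
  congr 2 <;> ring

lemma treeSumRight_succ (d h k : ℤ) :
    treeSumRight d h (k + 1) = treeSumRight d (h + 1) k + treeSum d (h + 1) (k + 1) := by
  rw [treeSum, treeSumRight, treeSumRight, ← orbitSum_add]
  congr 1
  funext a b c x y
  rw [show d + 1 + (k + 1) + b = d + 1 + k + b + 1 by ring, tripleSum_succ_second]
  congr 2 <;> ring

lemma treeSumLeft_zero {d k : ℤ} (hd : 0 ≤ d) (hk : 0 ≤ k) : treeSumLeft d 0 k = 0 := by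
  have e : ∀ {m n p u v m' n' u' : ℤ}, 0 ≤ n → 0 ≤ n' →
      (v < 0 ∨ 0 ≤ m ∧ m ≤ p + v) → m' = p + v - m → n' = n + m - u → u' = p + v - u →
      tripleSum m n p u v = tripleSum m' n' p u' v := by
    rintro m n p u v _ _ _ hn hn' h rfl rfl rfl
    exact tripleSum_reflect hn hn' h
  simp only [treeSumLeft, orbitSum]
  rw [e (m := d + 1 + 0 + -2) (p := d + 1) (v := d + 1 + -2) (m' := d + 1 + 0 + 0)
      (n' := d + 1 + k + 1) (u' := d + 1) (by omega) (by omega) (by omega) (by omega) (by omega)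
      (by omega),
    e (m := d + 1 + 0 + -2) (p := d + 2) (v := d + 1 + -3) (m' := d + 1 + 0 + 0)
      (n' := d + 1 + k + 0) (u' := d + 0) (by omega) (by omega) (by omega) (by omega) (by omega)
      (by omega),
    e (m := d + 1 + 0 + -1) (p := d + 2) (v := d + 1 + -2) (m' := d + 1 + 0 + 0)
      (n' := d + 1 + k + -1) (u' := d + -1) (by omega) (by omega) (by omega) (by omega) (by omega)
      (by omega),
    e (m := d + 1 + 0 + -1) (p := d + 0) (v := d + 1 + 0) (m' := d + 1 + 0 + 0)
      (n' := d + 1 + k + 1) (u' := d + 1) (by omega) (by omega) (by omega) (by omega) (by omega)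
      (by omega),
    e (n := d + 1 + k + -1) (p := d + 2) (v := d + 1 + -1) (m' := d + 1 + 0 + 0)
      (n' := d + 1 + k + 0) (u' := d + 2) (by omega) (by omega) (by omega) (by omega) (by omega)
      (by omega)]
  ring

lemma treeSumRight_zero {d : ℤ} (hd : 0 ≤ d) (h : ℤ) : treeSumRight d h 0 = 0 := by
  have e : ∀ {m n p u v m' n' p' u' v' : ℤ}, 0 ≤ n → 0 ≤ p → m' = n + m - u → n' = p → p' = n →
      u' = n + p - u → v' = v + p - u → tripleSum m n p u v = tripleSum m' n' p' u' v' := by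
    rintro m n p u v _ _ _ _ _ hn hp rfl rfl rfl rfl rfl
    exact tripleSum_swap hn hp m u v
  simp only [treeSumRight, orbitSum]
  rw [e (m := d + 1 + h + -2) (n := d + 1 + 0 + 1) (p := d + 1) (u := d + 1 + -1)
      (v := d + 1 + -2) (m' := d + 1 + h + 0) (n' := d + 1 + 0 + 0) (p' := d + 2)
      (u' := d + 1 + 2) (v' := d + 1 + -1) (by omega) (by omega) (by omega) (by omega)
      (by omega) (by omega) (by omega),
    e (m := d + 1 + h + 0) (n := d + 1 + 0 + 1) (p := d + 1) (u := d + 1 + 1)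
      (v := d + 1 + -2) (m' := d + 1 + h + 0) (n' := d + 1 + 0 + 0) (p' := d + 2)
      (u' := d + 1 + 0) (v' := d + 1 + -3) (by omega) (by omega) (by omega) (by omega)
      (by omega) (by omega) (by omega),
    e (m := d + 1 + h + -2) (n := d + 1 + 0 + 1) (p := d + 2) (u := d + 1 + 0)
      (v := d + 1 + -3) (m' := d + 1 + h + -1) (n' := d + 1 + 0 + 1) (p' := d + 2)
      (u' := d + 1 + 2) (v' := d + 1 + -2) (by omega) (by omega) (by omega) (by omega)
      (by omega) (by omega) (by omega),
    e (m := d + 1 + h + 0) (n := d + 1 + 0 + -1) (p := d + 2) (u := d + 1 + -1)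
      (v := d + 1 + -2) (m' := d + 1 + h + 0) (n' := d + 1 + 0 + 1) (p' := d + 0)
      (u' := d + 1 + 1) (v' := d + 1 + 0) (by omega) (by omega) (by omega) (by omega)
      (by omega) (by omega) (by omega),
    e (m := d + 1 + h + -1) (n := d + 1 + 0 + 1) (p := d + 0) (u := d + 1 + 0)
      (v := d + 1 + 0) (m' := d + 1 + h + 0) (n' := d + 1 + 0 + -1) (p' := d + 2)
      (u' := d + 1 + 0) (v' := d + 1 + -1) (by omega) (by omega) (by omega) (by omega)
      (by omega) (by omega) (by omega)]
  ring

lemma treeSum_zero (h k : ℤ) : treeSum 0 h k = 1 := by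
  have e : ∀ m n u : ℤ, tripleSum m n (0 + 0) u (0 + 0) = intChoose 0 u := by
    intro m n u
    rw [tripleSum, chooseConv, finsum_eq_single _ 0]
    · simp
    · intro s hs
      rcases lt_or_gt_of_ne hs with hs | hs
      · rw [intChoose_of_neg hs, zero_mul, zero_mul]
      · rw [intChoose_of_neg (show 0 + 0 - s < 0 by omega), mul_zero]
  have e1 : tripleSum (0 + h + 0) (0 + k + 1) (0 + 0) (0 + 1) (0 + 0) = 0 := by
    rw [e, intChoose_of_lt le_rfl (by norm_num)]
  have e2 : tripleSum (0 + h + -1) (0 + k + 1) (0 + 0) (0 + 0) (0 + 0) = 1 := by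
    rw [e]
    simp
  simp only [treeSum, orbitSum, e1, e2, tripleSum_of_neg (show (0 : ℤ) + -2 < 0 by norm_num),
    tripleSum_of_neg (show (0 : ℤ) + -3 < 0 by norm_num),
    tripleSum_of_neg (show (0 : ℤ) + -1 < 0 by norm_num)]
  norm_num

lemma treeSumLeft_eq_sum {d k : ℤ} (hd : 0 ≤ d) (hk : 0 ≤ k) (h : ℕ) :
    treeSumLeft d h k = ∑ i ∈ Finset.range h, treeSum d (i + 1) (k + 1) := by
  induction h with
  | zero => simpa using treeSumLeft_zero hd hk
  | succ h ih => rw [Finset.sum_range_succ, ← ih, Nat.cast_succ, treeSumLeft_succ]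

lemma treeSumRight_eq_sum {d : ℤ} (hd : 0 ≤ d) (h : ℤ) (k : ℕ) :
    treeSumRight d h k = ∑ i ∈ Finset.range k, treeSum d (h + i + 1) (k - i) := by
  induction k generalizing h with
  | zero => simpa using treeSumRight_zero hd h
  | succ k ih =>
    rw [Finset.sum_range_succ', Nat.cast_succ, treeSumRight_succ, ih]
    congr 1
    · refine Finset.sum_congr rfl fun i _ => ?_
      push_cast
      congr 1 <;> ring
    · simp

lemma treeCount_eq_treeSum (d h k : ℕ) : (treeCount d h k : ℤ) = treeSum d h k := by
  induction d generalizing h k with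
  | zero => rw [Nat.cast_zero, treeSum_zero, treeCount, Nat.cast_one]
  | succ d ih =>
    rw [treeCount, Nat.cast_succ, treeSum_succ, treeSumLeft_eq_sum (by omega) (by omega),
      treeSumRight_eq_sum (by omega)]
    push_cast
    congr 1
    · refine Finset.sum_congr rfl fun i _ => ?_
      rw [ih]
      push_cast
      rfl
    · refine Finset.sum_congr rfl fun i hi => ?_
      rw [ih, Nat.cast_sub (Finset.mem_range.1 hi).le]
      push_cast
      rfl

/-! ### Reciprocal factorials and the telescoping sum -/

/-- The reciprocal factorial on the integers, zero at negative arguments. -/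
def invFact (k : ℤ) : ℚ := if k < 0 then 0 else ((k.toNat.factorial : ℕ) : ℚ)⁻¹

lemma invFact_of_neg {k : ℤ} (h : k < 0) : invFact k = 0 := if_pos h

lemma invFact_natCast (k : ℕ) : invFact k = (k.factorial : ℚ)⁻¹ := by
  rw [invFact, if_neg (by omega), Int.toNat_natCast]

lemma invFact_ne_zero {k : ℤ} (h : 0 ≤ k) : invFact k ≠ 0 := by
  lift k to ℕ using h
  rw [invFact_natCast]
  positivity

lemma invFact_eq (k : ℤ) : invFact k = (k + 1) * invFact (k + 1) := by
  rcases lt_trichotomy k (-1) with h | rfl | h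
  · rw [invFact_of_neg (by omega), invFact_of_neg (by omega), mul_zero]
  · rw [invFact_of_neg (by omega)]
    norm_num
  · lift k to ℕ using (by omega)
    rw [← Nat.cast_succ, invFact_natCast, invFact_natCast, Nat.factorial_succ]
    push_cast
    field_simp

lemma invFact_eq_sub {k l : ℤ} (i : ℕ) (h : k + i = l) :
    invFact k = (∏ t ∈ Finset.range i, ((l : ℚ) - t)) * invFact l := by
  induction i generalizing k with
  | zero => simp [← h]
  | succ i ih =>
    rw [invFact_eq, ih (k := k + 1) (by push_cast at h; omega), Finset.prod_range_succ, ← h]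
    push_cast
    ring

lemma intChoose_eq_invFact {n : ℤ} (hn : 0 ≤ n) (k : ℤ) :
    (intChoose n k : ℚ) = invFact k * invFact (n - k) / invFact n := by
  rcases lt_or_ge k 0 with h | h
  · rw [intChoose_of_neg h, invFact_of_neg h]
    simp
  rcases lt_or_ge n k with h' | h'
  · rw [intChoose_of_lt hn h', invFact_of_neg (show n - k < 0 by omega)]
    simp
  lift n to ℕ using hn
  lift k to ℕ using h
  have hk : k ≤ n := by omega
  rw [intChoose_natCast, ← Nat.cast_sub hk, invFact_natCast, invFact_natCast, invFact_natCast,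
    Int.cast_natCast, Nat.cast_choose ℚ hk]
  field_simp

/-- The summand of `tripleSum` in a closed form of `treeCount`, as a product of factorials. -/
def treeTerm (n j a b c x y : ℤ) : ℚ :=
  invFact (n - j) * invFact (j + b) * invFact (j - 1 + x) * invFact (n - j + c - x) *
    invFact (j - 1 + y) * invFact (n + (a + b + 1 - y)) /
      (invFact (n + b) * invFact (n - 1 + c) * invFact (n + j + (a + b)))

lemma tripleSum_eq_sum_treeTerm (n : ℕ) (hn : 2 ≤ n) {a b c x y : ℤ} (hb : -1 ≤ b) (hc : 0 ≤ c)
    (hab : -1 ≤ a + b) (hy : y ≤ 0) :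
    (tripleSum (n + a) (n + b) (n - 1 + c) (n - 1 + x) (n - 1 + y) : ℚ) =
      ∑ j ∈ Finset.range (n + 2), treeTerm n j a b c x y := by
  let f : ℤ → ℤ := fun j => intChoose (n + b) (n - j) *
    intChoose (n - 1 + c) (n - 1 + x - (n - j)) *
      intChoose (n + b + (n + a) - (n - j)) (n - 1 + y - (n - j))
  have hf : tripleSum (n + a) (n + b) (n - 1 + c) (n - 1 + x) (n - 1 + y) = ∑ᶠ j, f j :=
    (finsum_comp_equiv (Equiv.subLeft (n : ℤ))).symm
  have hsum : ∑ᶠ j, f j = ∑ j ∈ (Finset.range (n + 2)).map Nat.castEmbedding, f j := by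
    refine finsum_eq_sum_of_support_subset _ fun j hj => ?_
    rw [Function.mem_support] at hj
    have h1 : j ≤ n := by
      by_contra h
      exact hj (by simp only [f, intChoose_of_neg (show (n : ℤ) - j < 0 by omega), zero_mul])
    have h2 : 0 ≤ j := by
      by_contra h
      exact hj (by simp only [f, intChoose_of_neg (show (n : ℤ) - 1 + y - (n - j) < 0 by omega),
        mul_zero])
    simp only [Finset.coe_map, Set.mem_image, Finset.mem_coe, Finset.mem_range,
      Nat.castEmbedding_apply]
    exact ⟨j.toNat, by omega, by omega⟩
  rw [hf, hsum, Finset.sum_map]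
  push_cast
  refine Finset.sum_congr rfl fun j _ => ?_
  simp only [f, Nat.castEmbedding_apply]
  push_cast
  rw [intChoose_eq_invFact (by omega), intChoose_eq_invFact (by omega),
    intChoose_eq_invFact (by omega), treeTerm, show (n : ℤ) + b - (n - j) = j + b by ring,
    show (n : ℤ) - 1 + x - (n - j) = j - 1 + x by ring,
    show (n : ℤ) - 1 + c - (j - 1 + x) = n - j + c - x by ring,
    show (n : ℤ) - 1 + y - (n - j) = j - 1 + y by ring,
    show (n : ℤ) + b + (n + a) - (n - j) = n + j + (a + b) by ring,
    show (n : ℤ) + j + (a + b) - (j - 1 + y) = n + (a + b + 1 - y) by ring]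
  ring

lemma apery_eq_sum_invFact (n m : ℕ) (h : n + 1 ≤ m) :
    (apery n : ℚ) = ∑ j ∈ Finset.range m,
      invFact j ^ 3 * invFact (n - j) ^ 2 / (invFact n * invFact (n + j)) := by
  have hz : ∀ j : ℕ, ((n.choose j) ^ 2 * (n + j).choose j : ℚ) =
      invFact j ^ 3 * invFact (n - j) ^ 2 / (invFact n * invFact (n + j)) := by
    intro j
    have h1 := intChoose_eq_invFact (n := n) (by omega) j
    have h2 := intChoose_eq_invFact (n := (n + j : ℕ)) (by omega) j
    have h3 := invFact_ne_zero (k := n) (by omega)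
    rw [intChoose_natCast, Int.cast_natCast] at h1 h2
    rw [h1, h2]
    push_cast
    rw [show (n : ℤ) + j - j = n by ring]
    field_simp
  rw [apery]
  push_cast
  rw [Finset.sum_congr rfl fun j _ => (hz j).symm]
  refine Finset.sum_subset (Finset.range_subset_range.2 h) fun j _ hj => ?_
  rw [Nat.choose_eq_zero_of_lt (by simpa using hj)]
  simp

/-- The common factor of the summands in the telescoping sum. -/
def commonFactor (n j : ℤ) : ℚ :=
  invFact (j + 1) ^ 2 * invFact j * invFact (n - j + 1) * invFact (n - j + 3) /
    (invFact n * invFact (n + j - 1))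

/-- The signed orbit sum of `treeTerm`, the summand of `treeSum (n - 1) 1 1`. -/
def orbitTerm (n j : ℤ) : ℚ :=
  -treeTerm n j (-2) 1 1 (-1) (-2) + treeTerm n j 0 1 1 1 (-2) - treeTerm n j 0 0 2 0 (-3) +
    treeTerm n j (-2) 1 2 0 (-3) - treeTerm n j (-1) 1 2 2 (-2) + treeTerm n j 0 (-1) 2 (-1)
    (-2) - treeTerm n j 0 1 0 1 0 + treeTerm n j (-1) 1 0 0 0 - treeTerm n j 0 (-1) 2 0 (-1) +
    treeTerm n j 0 0 2 2 (-1)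

/-- `orbitTerm` up to `commonFactor` and a factor depending only on `n`. -/
def orbitPoly (n j : ℚ) : ℚ :=
  -(n * (n + 3) * (n + 4) * (j - 1) * j * (j + 1) * (j - 2) * (j - 1) * j * (n - j + 1) * (n - j
    + 3)) + n * (j + 1) * (j - 2) * (j - 1) * j * (n - j + 1) * (n - j + 1) * (n - j + 2) * (n -
    j + 3) * (n + j) * (n + j + 1) - n * (j + 1) * j * (j + 1) * (j - 3) * (j - 2) * (j - 1) * j
    * (n - j + 1) * (n - j + 3) * (n + j) + n * (n + 1) * (n + 4) * j * (j + 1) * (j - 3) * (j -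
    2) * (j - 1) * j * (n - j + 1) * (n - j + 3) - n * (n + 1) * (n + 4) * (j - 2) * (j - 1) * j
    * (n - j + 1) * (n - j + 1) * (n - j + 2) * (n - j + 3) * (n + j) + (n + 3) * (n + 4) * j *
    (j + 1) * (j - 1) * j * (j + 1) * (j - 2) * (j - 1) * j * (n - j + 1) - (n + 3) * (n + 4) *
    (j + 1) * j * (n - j + 1) * (n - j) * (n - j + 1) * (n - j + 2) * (n - j + 3) * (n + j) * (n
    + j + 1) + (n + 2) * (n + 3) * (n + 4) * j * (j + 1) * j * (n - j + 1) * (n - j + 1) * (n -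
    j + 2) * (n - j + 3) * (n + j) - (n + 2) * (n + 3) * (n + 4) * j * (j + 1) * j * (j + 1) *
    (j - 1) * j * (n - j + 1) * (n - j + 3) + n * (n + 3) * (n + 4) * (j + 1) * (j - 1) * j * (n
    - j + 1) * (n - j + 1) * (n - j + 2) * (n - j + 3) * (n + j)

/-- The polynomial part of the certificate of the telescoping sum. -/
def certPoly (n j : ℚ) : ℚ :=
  (30 * n ^ 10 + 450 * n ^ 9 + 2700 * n ^ 8 + 8100 * n ^ 7 + 11790 * n ^ 6 + 4050 * n ^ 5 - 10200
  * n ^ 4 - 12600 * n ^ 3 - 4320 * n ^ 2) + (5 * n ^ 11 + 50 * n ^ 10 + 25 * n ^ 9 - 1360 * n ^ 8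
  - 6005 * n ^ 7 - 8650 * n ^ 6 + 1895 * n ^ 5 + 15360 * n ^ 4 + 8400 * n ^ 3 - 5400 * n ^ 2 -
  4320 * n) * j + (-5 * n ^ 11 - 95 * n ^ 10 - 685 * n ^ 9 - 2630 * n ^ 8 - 6845 * n ^ 7 - 14585 *
  n ^ 6 - 21725 * n ^ 5 - 9450 * n ^ 4 + 23548 * n ^ 3 + 35640 * n ^ 2 + 14688 * n) * j ^ 2 + (15
  * n ^ 10 + 215 * n ^ 9 + 1345 * n ^ 8 + 5105 * n ^ 7 + 12645 * n ^ 6 + 17255 * n ^ 5 + 2585 * n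
  ^ 4 - 23895 * n ^ 3 - 23838 * n ^ 2 - 120 * n + 6048) * j ^ 3 + (-5 * n ^ 9 - 40 * n ^ 8 - 195 *
  n ^ 7 - 565 * n ^ 6 + 415 * n ^ 5 + 6335 * n ^ 4 + 10165 * n ^ 3 - 2310 * n ^ 2 - 16128 * n -
  9360) * j ^ 4 + (-15 * n ^ 8 - 165 * n ^ 7 - 805 * n ^ 6 - 2520 * n ^ 5 - 5030 * n ^ 4 - 3735 *
  n ^ 3 + 4830 * n ^ 2 + 9960 * n + 4608) * j ^ 5 + (5 * n ^ 7 + 45 * n ^ 6 + 240 * n ^ 5 + 705 *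
  n ^ 4 + 655 * n ^ 3 - 810 * n ^ 2 - 1680 * n - 720) * j ^ 6 + (5 * n ^ 6 + 30 * n ^ 5 + 55 * n ^
  4 + 30 * n ^ 3) * j ^ 7

lemma certPoly_identity (n j : ℚ) :
    (n + 1) * (5 * (n - 1) * n * (n + 2) * (n + 3) * orbitPoly n j -
      24 * ((5 * n ^ 3 - 5 * n + 6) *
          ((n + 1) * (n + j) * (n + j + 1) * (j + 1) ^ 2 * (n - j + 2) * (n - j + 3)) -
        (5 * n ^ 2 + 15 * n + 18) *
          ((n + j) * (j + 1) ^ 2 * (n - j + 1) * ((n - j + 1) * (n - j + 2) * (n - j + 3))))) =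
      (n + j) * (n - j + 1) * (n - j + 3) * certPoly n (j + 1) -
        (j + 1) ^ 2 * j * certPoly n j := by
  simp only [certPoly, orbitPoly]
  ring

set_option maxHeartbeats 1000000 in
lemma treeTerm_orbit (n j : ℕ) (hn : 2 ≤ n) :
    (n : ℚ) * (n + 2) * (n + 3) * (n + 4) *
        orbitTerm n j =
      commonFactor n j * orbitPoly n j := by
  obtain ⟨f, hf⟩ : ∃ f, f = invFact (n + 4 : ℤ) := ⟨_, rfl⟩
  obtain ⟨e, he⟩ : ∃ e, e = invFact (n + j + 1 : ℤ) := ⟨_, rfl⟩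
  obtain ⟨u, hu⟩ : ∃ u, u = invFact (j + 1 : ℤ) := ⟨_, rfl⟩
  obtain ⟨w, hw⟩ : ∃ w, w = invFact (n - j + 3 : ℤ) := ⟨_, rfl⟩
  have hf0 : f ≠ 0 := hf ▸ invFact_ne_zero (by omega)
  have he0 : e ≠ 0 := he ▸ invFact_ne_zero (by omega)
  have hn0 : (0 : ℚ) < n := Nat.cast_pos.2 (by omega)
  have hnp0 : invFact (n : ℤ) = (n + 1) * (n + 2) * (n + 3) * (n + 4) * f := by
    rw [invFact_eq_sub 4 (l := n + 4) (by push_cast; ring), ← hf]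
    simp only [Finset.prod_range_succ, Finset.prod_range_zero]
    push_cast
    ring
  have hsm1 : invFact (n + j - 1 : ℤ) = (n + j) * (n + j + 1) * e := by
    rw [invFact_eq_sub 2 (l := n + j + 1) (by push_cast; ring), ← he]
    simp only [Finset.prod_range_succ, Finset.prod_range_zero]
    push_cast
    ring
  have hjp0 : invFact (j : ℤ) = (j + 1) * u := by
    rw [invFact_eq_sub 1 (l := j + 1) (by push_cast; ring), ← hu]
    simp only [Finset.prod_range_succ, Finset.prod_range_zero]
    push_cast
    ring
  have hdp1 : invFact (n - j + 1 : ℤ) = (n - j + 2) * (n - j + 3) * w := by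
    rw [invFact_eq_sub 2 (l := n - j + 3) (by push_cast; ring), ← hw]
    simp only [Finset.prod_range_succ, Finset.prod_range_zero]
    push_cast
    ring
  have hjp1 : invFact (j + 1 : ℤ) = u := hu.symm
  have hdp3 : invFact (n - j + 3 : ℤ) = w := hw.symm
  have hdp0 : invFact (n - j : ℤ) = (n - j + 1) * (n - j + 2) * (n - j + 3) * w := by
    rw [invFact_eq_sub 3 (l := n - j + 3) (by push_cast; ring), ← hw]
    simp only [Finset.prod_range_succ, Finset.prod_range_zero]
    push_cast
    ring
  have hjm2 : invFact (j - 2 : ℤ) = (j - 1) * j * (j + 1) * u := by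
    rw [invFact_eq_sub 3 (l := j + 1) (by push_cast; ring), ← hu]
    simp only [Finset.prod_range_succ, Finset.prod_range_zero]
    push_cast
    ring
  have hdp2 : invFact (n - j + 2 : ℤ) = (n - j + 3) * w := by
    rw [invFact_eq_sub 1 (l := n - j + 3) (by push_cast; ring), ← hw]
    simp only [Finset.prod_range_succ, Finset.prod_range_zero]
    push_cast
    ring
  have hjm3 : invFact (j - 3 : ℤ) = (j - 2) * (j - 1) * j * (j + 1) * u := by
    rw [invFact_eq_sub 4 (l := j + 1) (by push_cast; ring), ← hu]
    simp only [Finset.prod_range_succ, Finset.prod_range_zero]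
    push_cast
    ring
  have hnp2 : invFact (n + 2 : ℤ) = (n + 3) * (n + 4) * f := by
    rw [invFact_eq_sub 2 (l := n + 4) (by push_cast; ring), ← hf]
    simp only [Finset.prod_range_succ, Finset.prod_range_zero]
    push_cast
    ring
  have hnp1 : invFact (n + 1 : ℤ) = (n + 2) * (n + 3) * (n + 4) * f := by
    rw [invFact_eq_sub 3 (l := n + 4) (by push_cast; ring), ← hf]
    simp only [Finset.prod_range_succ, Finset.prod_range_zero]
    push_cast
    ring
  have hnp4 : invFact (n + 4 : ℤ) = f := hf.symm
  have hsp1 : invFact (n + j + 1 : ℤ) = e := he.symm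
  have hjm1 : invFact (j - 1 : ℤ) = j * (j + 1) * u := by
    rw [invFact_eq_sub 2 (l := j + 1) (by push_cast; ring), ← hu]
    simp only [Finset.prod_range_succ, Finset.prod_range_zero]
    push_cast
    ring
  have hjm4 : invFact (j - 4 : ℤ) = (j - 3) * (j - 2) * (j - 1) * j * (j + 1) * u := by
    rw [invFact_eq_sub 5 (l := j + 1) (by push_cast; ring), ← hu]
    simp only [Finset.prod_range_succ, Finset.prod_range_zero]
    push_cast
    ring
  have hsp0 : invFact (n + j : ℤ) = (n + j + 1) * e := by
    rw [invFact_eq_sub 1 (l := n + j + 1) (by push_cast; ring), ← he]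
    simp only [Finset.prod_range_succ, Finset.prod_range_zero]
    push_cast
    ring
  have hnp3 : invFact (n + 3 : ℤ) = (n + 4) * f := by
    rw [invFact_eq_sub 1 (l := n + 4) (by push_cast; ring), ← hf]
    simp only [Finset.prod_range_succ, Finset.prod_range_zero]
    push_cast
    ring
  have hnm1 : invFact (n - 1 : ℤ) = n * (n + 1) * (n + 2) * (n + 3) * (n + 4) * f := by
    rw [invFact_eq_sub 5 (l := n + 4) (by push_cast; ring), ← hf]
    simp only [Finset.prod_range_succ, Finset.prod_range_zero]
    push_cast
    ring
  have hdm1 : invFact (n - j - 1 : ℤ) = (n - j) * (n - j + 1) * (n - j + 2) * (n - j + 3) * w := by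
    rw [invFact_eq_sub 4 (l := n - j + 3) (by push_cast; ring), ← hw]
    simp only [Finset.prod_range_succ, Finset.prod_range_zero]
    push_cast
    ring
  have hc : commonFactor n j =
      u ^ 2 * ((j + 1) * u) * ((n - j + 2) * (n - j + 3) * w) * w /
        ((n + 1) * (n + 2) * (n + 3) * (n + 4) * f * ((n + j) * (n + j + 1) * e)) := by
    rw [commonFactor, hjp1, hjp0, hdp1, hdp3, hnp0, hsm1]
  have h : ∀ {a b c x y : ℤ} (k₁ k₂ k₃ k₄ k₅ k₆ k₇ k₈ : ℤ), j + b = k₁ → j - 1 + x = k₂ →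
      n - j + c - x = k₃ → j - 1 + y = k₄ → n + (a + b + 1 - y) = k₅ → n + b = k₆ →
      n - 1 + c = k₇ → n + j + (a + b) = k₈ → treeTerm n j a b c x y =
        invFact (n - j) * invFact k₁ * invFact k₂ * invFact k₃ * invFact k₄ * invFact k₅ /
          (invFact k₆ * invFact k₇ * invFact k₈) := by
    rintro a b c x y _ _ _ _ _ _ _ _ rfl rfl rfl rfl rfl rfl rfl rfl
    rfl
  obtain ⟨n₁, en₁⟩ : ∃ q, q = (n : ℚ) + 1 := ⟨_, rfl⟩
  obtain ⟨n₂, en₂⟩ : ∃ q, q = (n : ℚ) + 2 := ⟨_, rfl⟩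
  obtain ⟨n₃, en₃⟩ : ∃ q, q = (n : ℚ) + 3 := ⟨_, rfl⟩
  obtain ⟨n₄, en₄⟩ : ∃ q, q = (n : ℚ) + 4 := ⟨_, rfl⟩
  obtain ⟨s₀, es₀⟩ : ∃ q, q = (n : ℚ) + j := ⟨_, rfl⟩
  obtain ⟨s₁, es₁⟩ : ∃ q, q = s₀ + 1 := ⟨_, rfl⟩
  obtain ⟨j₁, ej₁⟩ : ∃ q, q = (j : ℚ) + 1 := ⟨_, rfl⟩
  obtain ⟨i₁, ei₁⟩ : ∃ q, q = (j : ℚ) - 1 := ⟨_, rfl⟩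
  obtain ⟨i₂, ei₂⟩ : ∃ q, q = (j : ℚ) - 2 := ⟨_, rfl⟩
  obtain ⟨i₃, ei₃⟩ : ∃ q, q = (j : ℚ) - 3 := ⟨_, rfl⟩
  obtain ⟨d₀, ed₀⟩ : ∃ q, q = (n : ℚ) - j := ⟨_, rfl⟩
  obtain ⟨d₁, ed₁⟩ : ∃ q, q = d₀ + 1 := ⟨_, rfl⟩
  obtain ⟨d₂, ed₂⟩ : ∃ q, q = d₀ + 2 := ⟨_, rfl⟩
  obtain ⟨d₃, ed₃⟩ : ∃ q, q = d₀ + 3 := ⟨_, rfl⟩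
  have pn₁ : n₁ ≠ 0 := by rw [en₁]; positivity
  have pn₂ : n₂ ≠ 0 := by rw [en₂]; positivity
  have pn₃ : n₃ ≠ 0 := by rw [en₃]; positivity
  have pn₄ : n₄ ≠ 0 := by rw [en₄]; positivity
  have ps₀ : s₀ ≠ 0 := by rw [es₀]; positivity
  have ps₁ : s₁ ≠ 0 := by rw [es₁, es₀]; positivity
  have t0 : (n : ℚ) * (n + 2) * (n + 3) * (n + 4) * treeTerm n j (-2) 1 1 (-1) (-2) =
      commonFactor n j *
        (n * (n + 3) * (n + 4) * (j - 1) * j * (j + 1) * (j - 2) * (j - 1) * j * (n - j + 1) * (n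
          - j + 3)) := by
    rw [hc, h (j + 1 : ℤ) (j - 2 : ℤ) (n - j + 2 : ℤ) (j - 3 : ℤ) (n + 2 : ℤ) (n + 1 : ℤ) n
        (n + j - 1 : ℤ)
        (by ring) (by ring) (by ring) (by ring) (by ring) (by ring) (by ring) (by ring),
      hdp0, hjp1, hjm2, hdp2, hjm3, hnp2, hnp1, hnp0, hsm1]
    simp only [← en₁, ← en₂, ← en₃, ← en₄, ← es₀, ← es₁, ← ej₁, ← ei₁, ← ei₂, ← ed₀, ← ed₁, ← ed₂, ←
      ed₃]
    rw [mul_div_assoc', div_mul_eq_mul_div, div_eq_div_iff (by positivity) (by positivity)]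
    ring
  have t1 : (n : ℚ) * (n + 2) * (n + 3) * (n + 4) * treeTerm n j 0 1 1 1 (-2) =
      commonFactor n j *
        (n * (j + 1) * (j - 2) * (j - 1) * j * (n - j + 1) * (n - j + 1) * (n - j + 2) * (n - j +
          3) * (n + j) * (n + j + 1)) := by
    rw [hc, h (j + 1 : ℤ) j (n - j : ℤ) (j - 3 : ℤ) (n + 4 : ℤ) (n + 1 : ℤ) n (n + j + 1 : ℤ)
        (by ring) (by ring) (by ring) (by ring) (by ring) (by ring) (by ring) (by ring),
      hdp0, hjp1, hjp0, hjm3, hnp4, hnp1, hnp0, hsp1]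
    simp only [← en₁, ← en₂, ← en₃, ← en₄, ← es₀, ← es₁, ← ej₁, ← ei₁, ← ei₂, ← ed₀, ← ed₁, ← ed₂, ←
      ed₃]
    rw [mul_div_assoc', div_mul_eq_mul_div, div_eq_div_iff (by positivity) (by positivity)]
    ring
  have t2 : (n : ℚ) * (n + 2) * (n + 3) * (n + 4) * treeTerm n j 0 0 2 0 (-3) =
      commonFactor n j *
        (n * (j + 1) * j * (j + 1) * (j - 3) * (j - 2) * (j - 1) * j * (n - j + 1) * (n - j + 3)
          * (n + j)) := by
    rw [hc, h j (j - 1 : ℤ) (n - j + 2 : ℤ) (j - 4 : ℤ) (n + 4 : ℤ) n (n + 1 : ℤ) (n + j : ℤ)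
        (by ring) (by ring) (by ring) (by ring) (by ring) (by ring) (by ring) (by ring),
      hdp0, hjp0, hjm1, hdp2, hjm4, hnp4, hnp0, hnp1, hsp0]
    simp only [← en₁, ← en₂, ← en₃, ← en₄, ← es₀, ← es₁, ← ej₁, ← ei₁, ← ei₂, ← ei₃, ← ed₀,
      ← ed₁, ← ed₂, ←
      ed₃]
    rw [mul_div_assoc', div_mul_eq_mul_div, div_eq_div_iff (by positivity) (by positivity)]
    ring
  have t3 : (n : ℚ) * (n + 2) * (n + 3) * (n + 4) * treeTerm n j (-2) 1 2 0 (-3) =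
      commonFactor n j *
        (n * (n + 1) * (n + 4) * j * (j + 1) * (j - 3) * (j - 2) * (j - 1) * j * (n - j + 1) * (n
          - j + 3)) := by
    rw [hc, h (j + 1 : ℤ) (j - 1 : ℤ) (n - j + 2 : ℤ) (j - 4 : ℤ) (n + 3 : ℤ) (n + 1 : ℤ)
        (n + 1 : ℤ)
        (n + j - 1 : ℤ)
        (by ring) (by ring) (by ring) (by ring) (by ring) (by ring) (by ring) (by ring),
      hdp0, hjp1, hjm1, hdp2, hjm4, hnp3, hnp1, hsm1]
    simp only [← en₁, ← en₂, ← en₃, ← en₄, ← es₀, ← es₁, ← ej₁, ← ei₁, ← ei₂, ← ei₃, ← ed₀,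
      ← ed₁, ← ed₂, ←
      ed₃]
    rw [mul_div_assoc', div_mul_eq_mul_div, div_eq_div_iff (by positivity) (by positivity)]
    ring
  have t4 : (n : ℚ) * (n + 2) * (n + 3) * (n + 4) * treeTerm n j (-1) 1 2 2 (-2) =
      commonFactor n j *
        (n * (n + 1) * (n + 4) * (j - 2) * (j - 1) * j * (n - j + 1) * (n - j + 1) * (n - j + 2)
          * (n - j + 3) * (n + j)) := by
    rw [hc, h (j + 1 : ℤ) (j + 1 : ℤ) (n - j : ℤ) (j - 3 : ℤ) (n + 3 : ℤ) (n + 1 : ℤ) (n + 1 : ℤ)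
        (n + j : ℤ)
        (by ring) (by ring) (by ring) (by ring) (by ring) (by ring) (by ring) (by ring),
      hdp0, hjp1, hjm3, hnp3, hnp1, hsp0]
    simp only [← en₁, ← en₂, ← en₃, ← en₄, ← es₀, ← es₁, ← ej₁, ← ei₁, ← ei₂, ← ed₀, ← ed₁, ← ed₂, ←
      ed₃]
    rw [mul_div_assoc', div_mul_eq_mul_div, div_eq_div_iff (by positivity) (by positivity)]
    ring
  have t5 : (n : ℚ) * (n + 2) * (n + 3) * (n + 4) * treeTerm n j 0 (-1) 2 (-1) (-2) =
      commonFactor n j *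
        ((n + 3) * (n + 4) * j * (j + 1) * (j - 1) * j * (j + 1) * (j - 2) * (j - 1) * j * (n - j
          + 1)) := by
    rw [hc, h (j - 1 : ℤ) (j - 2 : ℤ) (n - j + 3 : ℤ) (j - 3 : ℤ) (n + 2 : ℤ) (n - 1 : ℤ)
        (n + 1 : ℤ)
        (n + j - 1 : ℤ)
        (by ring) (by ring) (by ring) (by ring) (by ring) (by ring) (by ring) (by ring),
      hdp0, hjm1, hjm2, hdp3, hjm3, hnp2, hnm1, hnp1, hsm1]
    simp only [← en₁, ← en₂, ← en₃, ← en₄, ← es₀, ← es₁, ← ej₁, ← ei₁, ← ei₂, ← ed₀, ← ed₁, ← ed₂, ←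
      ed₃]
    rw [mul_div_assoc', div_mul_eq_mul_div, div_eq_div_iff (by positivity) (by positivity)]
    ring
  have t6 : (n : ℚ) * (n + 2) * (n + 3) * (n + 4) * treeTerm n j 0 1 0 1 0 =
      commonFactor n j *
        ((n + 3) * (n + 4) * (j + 1) * j * (n - j + 1) * (n - j) * (n - j + 1) * (n - j + 2) * (n
          - j + 3) * (n + j) * (n + j + 1)) := by
    rw [hc, h (j + 1 : ℤ) j (n - j - 1 : ℤ) (j - 1 : ℤ) (n + 2 : ℤ) (n + 1 : ℤ) (n - 1 : ℤ)
        (n + j + 1 : ℤ)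
        (by ring) (by ring) (by ring) (by ring) (by ring) (by ring) (by ring) (by ring),
      hdp0, hjp1, hjp0, hdm1, hjm1, hnp2, hnp1, hnm1, hsp1]
    simp only [← en₁, ← en₂, ← en₃, ← en₄, ← es₀, ← es₁, ← ej₁, ← ed₀, ← ed₁, ← ed₂, ←
      ed₃]
    rw [mul_div_assoc', div_mul_eq_mul_div, div_eq_div_iff (by positivity) (by positivity)]
    ring
  have t7 : (n : ℚ) * (n + 2) * (n + 3) * (n + 4) * treeTerm n j (-1) 1 0 0 0 =
      commonFactor n j *
        ((n + 2) * (n + 3) * (n + 4) * j * (j + 1) * j * (n - j + 1) * (n - j + 1) * (n - j + 2)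
          * (n - j + 3) * (n + j)) := by
    rw [hc, h (j + 1 : ℤ) (j - 1 : ℤ) (n - j : ℤ) (j - 1 : ℤ) (n + 1 : ℤ) (n + 1 : ℤ) (n - 1 : ℤ)
        (n + j : ℤ)
        (by ring) (by ring) (by ring) (by ring) (by ring) (by ring) (by ring) (by ring),
      hdp0, hjp1, hjm1, hnp1, hnm1, hsp0]
    simp only [← en₁, ← en₂, ← en₃, ← en₄, ← es₀, ← es₁, ← ej₁, ← ed₀, ← ed₁, ← ed₂, ←
      ed₃]
    rw [mul_div_assoc', div_mul_eq_mul_div, div_eq_div_iff (by positivity) (by positivity)]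
    ring
  have t8 : (n : ℚ) * (n + 2) * (n + 3) * (n + 4) * treeTerm n j 0 (-1) 2 0 (-1) =
      commonFactor n j *
        ((n + 2) * (n + 3) * (n + 4) * j * (j + 1) * j * (j + 1) * (j - 1) * j * (n - j + 1) * (n
          - j + 3)) := by
    rw [hc, h (j - 1 : ℤ) (j - 1 : ℤ) (n - j + 2 : ℤ) (j - 2 : ℤ) (n + 1 : ℤ) (n - 1 : ℤ)
        (n + 1 : ℤ)
        (n + j - 1 : ℤ)
        (by ring) (by ring) (by ring) (by ring) (by ring) (by ring) (by ring) (by ring),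
      hdp0, hjm1, hdp2, hjm2, hnp1, hnm1, hsm1]
    simp only [← en₁, ← en₂, ← en₃, ← en₄, ← es₀, ← es₁, ← ej₁, ← ei₁, ← ed₀, ← ed₁, ← ed₂, ←
      ed₃]
    rw [mul_div_assoc', div_mul_eq_mul_div, div_eq_div_iff (by positivity) (by positivity)]
    ring
  have t9 : (n : ℚ) * (n + 2) * (n + 3) * (n + 4) * treeTerm n j 0 0 2 2 (-1) =
      commonFactor n j *
        (n * (n + 3) * (n + 4) * (j + 1) * (j - 1) * j * (n - j + 1) * (n - j + 1) * (n - j + 2)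
          * (n - j + 3) * (n + j)) := by
    rw [hc, h j (j + 1 : ℤ) (n - j : ℤ) (j - 2 : ℤ) (n + 2 : ℤ) n (n + 1 : ℤ) (n + j : ℤ)
        (by ring) (by ring) (by ring) (by ring) (by ring) (by ring) (by ring) (by ring),
      hdp0, hjp0, hjp1, hjm2, hnp2, hnp0, hnp1, hsp0]
    simp only [← en₁, ← en₂, ← en₃, ← en₄, ← es₀, ← es₁, ← ej₁, ← ei₁, ← ed₀, ← ed₁, ← ed₂, ←
      ed₃]
    rw [mul_div_assoc', div_mul_eq_mul_div, div_eq_div_iff (by positivity) (by positivity)]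
    ring
  rw [orbitTerm, orbitPoly]
  linear_combination -t0 + t1 - t2 + t3 - t4 + t5 - t6 + t7 - t8 + t9

/-- The summand of `apery`, as a product of reciprocal factorials. -/
def aperyTerm (n j : ℤ) : ℚ :=
  invFact j ^ 3 * invFact (n - j) ^ 2 / (invFact n * invFact (n + j))

/-- The antidifference certifying the telescoping sum. -/
def certTerm (n j : ℤ) : ℚ :=
  certPoly n j / (n + 1) * (invFact j ^ 2 * invFact (j - 1) * invFact (n - j + 1) *
    invFact (n - j + 3) / (invFact n * invFact (n + j - 1)))

lemma invFact_sub_one (k : ℤ) : invFact (k - 1) = k * invFact k := by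
  rw [invFact_eq, sub_add_cancel]
  push_cast
  ring

lemma certTerm_eq (n j : ℤ) :
    certTerm n j = commonFactor n j * ((j + 1) ^ 2 * j * certPoly n j) / (n + 1) := by
  rw [certTerm, commonFactor, invFact_sub_one j, invFact_eq j]
  ring

lemma certTerm_succ (n j : ℕ) (hn : 0 < n) :
    certTerm n (j + 1) =
      commonFactor n j * ((n + j) * (n - j + 1) * (n - j + 3) * certPoly n (j + 1)) / (n + 1) := by
  have h1 := invFact_sub_one (n - j + 1)
  have h2 := invFact_sub_one (n - j + 3)
  have h3 := invFact_sub_one (n + j)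
  have h4 := invFact_ne_zero (k := n + j) (by omega)
  have h5 := invFact_ne_zero (k := n) (by omega)
  have h6 : (0 : ℚ) < n := Nat.cast_pos.2 hn
  push_cast at h1 h2 h3
  rw [certTerm, commonFactor, show (n : ℤ) - (j + 1) + 1 = n - j + 1 - 1 by ring,
    show (n : ℤ) - (j + 1) + 3 = n - j + 3 - 1 by ring, add_sub_cancel_right,
    show (n : ℤ) + (j + 1) - 1 = n + j by ring, h1, h2, h3]
  push_cast
  generalize certPoly n (j + 1) = p
  have h7 : (n : ℚ) + j ≠ 0 := by positivity
  field_simp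

lemma aperyTerm_eq (n j : ℕ) (hn : 0 < n) :
    aperyTerm n j = commonFactor n j *
      ((n + j) * (j + 1) ^ 2 * (n - j + 1) * ((n - j + 1) * (n - j + 2) * (n - j + 3))) := by
  have h1 := invFact_eq (n - j)
  have h2 := invFact_eq_sub (k := n - j) (l := n - j + 3) 3 (by push_cast; ring)
  have h3 := invFact_sub_one (n + j)
  have h4 := invFact_ne_zero (k := n + j) (by omega)
  have h5 := invFact_ne_zero (k := n) (by omega)
  have h6 : (0 : ℚ) < n := Nat.cast_pos.2 hn
  have h7 : (n : ℚ) + j ≠ 0 := by positivity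
  simp only [Finset.prod_range_succ, Finset.prod_range_zero] at h2
  push_cast at h1 h2 h3
  rw [aperyTerm, commonFactor, h3, pow_two (invFact (n - j))]
  nth_rw 1 [h1]
  rw [h2, show invFact (j : ℤ) ^ 3 = invFact j ^ 2 * invFact j by ring]
  nth_rw 1 [invFact_eq j]
  push_cast
  field_simp
  ring

lemma aperyTerm_succ (n j : ℕ) (hn : 0 < n) :
    aperyTerm (n + 1) j = commonFactor n j *
      ((n + 1) * (n + j) * (n + j + 1) * (j + 1) ^ 2 * (n - j + 2) * (n - j + 3)) := by
  have h2 := invFact_eq_sub (k := n - j + 1) (l := n - j + 3) 2 (by push_cast; ring)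
  have h3 : invFact (n + j - 1) = (n + j) * (n + j + 1) * invFact (n + j + 1) := by
    rw [invFact_sub_one, invFact_eq]
    push_cast
    ring
  have h4 := invFact_ne_zero (k := n + j + 1) (by omega)
  have h5 := invFact_ne_zero (k := n + 1) (by omega)
  have h6 : (0 : ℚ) < n := Nat.cast_pos.2 hn
  have h7 : (n : ℚ) + j ≠ 0 := by positivity
  have h8 : (n : ℚ) + j + 1 ≠ 0 := by positivity
  simp only [Finset.prod_range_succ, Finset.prod_range_zero] at h2
  push_cast at h2
  rw [aperyTerm, commonFactor, h3, show (n : ℤ) + 1 - j = n - j + 1 by ring,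
    show (n : ℤ) + 1 + j = n + j + 1 by ring, pow_two (invFact (n - j + 1))]
  nth_rw 1 [h2]
  rw [show invFact (j : ℤ) ^ 3 = invFact j ^ 2 * invFact j by ring, invFact_eq n]
  nth_rw 1 [invFact_eq j]
  push_cast
  field_simp
  ring

lemma certTerm_sub (n j : ℕ) (hn : 2 ≤ n) :
    5 * ((n : ℚ) - 1) * n ^ 2 * (n + 2) ^ 2 * (n + 3) ^ 2 * (n + 4) * orbitTerm n j -
        24 * ((5 * n ^ 3 - 5 * n + 6) * aperyTerm (n + 1) j -
          (5 * n ^ 2 + 15 * n + 18) * aperyTerm n j) =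
      certTerm n (j + 1) - certTerm n j := by
  have h : (n : ℚ) + 1 ≠ 0 := by positivity
  rw [aperyTerm_eq n j (by omega), aperyTerm_succ n j (by omega), certTerm_succ n j (by omega),
    certTerm_eq, Int.cast_natCast, Int.cast_natCast, ← sub_div, eq_div_iff h]
  linear_combination 5 * ((n : ℚ) - 1) * n * (n + 2) * (n + 3) * (n + 1) * treeTerm_orbit n j hn +
    commonFactor n j * certPoly_identity n j

lemma sum_orbitTerm (n : ℕ) (hn : 2 ≤ n) :
    5 * ((n : ℚ) - 1) * n ^ 2 * (n + 2) ^ 2 * (n + 3) ^ 2 * (n + 4) *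
        ∑ j ∈ Finset.range (n + 2), orbitTerm n j =
      24 * ((5 * n ^ 3 - 5 * n + 6) * apery (n + 1) - (5 * n ^ 2 + 15 * n + 18) * apery n) := by
  have h0 : certTerm n 0 = 0 := by
    rw [certTerm, invFact_of_neg (show (0 : ℤ) - 1 < 0 by norm_num)]
    simp
  have h1 : certTerm n (n + 2) = 0 := by
    rw [certTerm, invFact_of_neg (show (n : ℤ) - (n + 2) + 1 < 0 by omega)]
    simp
  have h := Finset.sum_range_sub (fun j : ℕ => certTerm n j) (n + 2)
  push_cast at h
  rw [h0, h1, Finset.sum_congr rfl fun j _ => (certTerm_sub n j hn).symm] at h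
  simp only [Finset.sum_sub_distrib, ← Finset.mul_sum] at h
  have e0 : (apery n : ℚ) = ∑ j ∈ Finset.range (n + 2), aperyTerm n j :=
    apery_eq_sum_invFact n (n + 2) (by omega)
  have e1 : (apery (n + 1) : ℚ) = ∑ j ∈ Finset.range (n + 2), aperyTerm (n + 1) j := by
    have := apery_eq_sum_invFact (n + 1) (n + 2) le_rfl
    push_cast at this
    exact this
  rw [e0, e1]
  linear_combination h

lemma treeSum_eq_sum_orbitTerm (n : ℕ) (hn : 2 ≤ n) :
    (treeSum (n - 1) 1 1 : ℚ) = ∑ j ∈ Finset.range (n + 2), orbitTerm n j := by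
  have h : treeSum (n - 1) 1 1 = orbitSum fun a b c x y =>
      tripleSum (n + a) (n + b) (n - 1 + c) (n - 1 + x) (n - 1 + y) := by
    simp only [treeSum, sub_add_cancel]
  rw [h, orbitSum]
  push_cast
  repeat rw [tripleSum_eq_sum_treeTerm n hn (by norm_num) (by norm_num) (by norm_num) (by norm_num)]
  simp only [orbitTerm, Finset.sum_add_distrib, Finset.sum_sub_distrib, Finset.sum_neg_distrib]

/-- Proposition 3.16: the semi-Baxter numbers in terms of the Apéry numbers. -/
theorem semiBaxter_apery_formula (n : ℕ) (hn : 2 ≤ n) :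
    5 * ((n : ℤ) - 1) * (n : ℤ) ^ 2 * ((n : ℤ) + 2) ^ 2 * ((n : ℤ) + 3) ^ 2 * ((n : ℤ) + 4) *
        (semiBaxterCount n : ℤ) =
      24 * ((5 * (n : ℤ) ^ 3 - 5 * (n : ℤ) + 6) * (apery (n + 1) : ℤ) -
        (5 * (n : ℤ) ^ 2 + 15 * (n : ℤ) + 18) * (apery n : ℤ)) := by
  obtain ⟨d, rfl⟩ : ∃ d, n = d + 1 := ⟨n - 1, by omega⟩
  have h := sum_orbitTerm (d + 1) hn
  rw [← treeSum_eq_sum_orbitTerm (d + 1) hn] at h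
  have hd : (semiBaxterCount (d + 1) : ℤ) = treeSum ((d + 1 : ℕ) - 1) 1 1 := by
    rw [semiBaxterCount_succ, treeCount_eq_treeSum]
    push_cast
    rw [add_sub_cancel_right]
  rw [hd]
  exact_mod_cast h
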